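/- Let L, L̃ be two n×n real symmetric matrices (graph Laplacians of a graph and its subsampled version), φ(L) = σ((h₀I + h₁L)x) with σ elementwise C_σ-Lipschitz and ‖x‖₂ = 1, and let y(G), y(G̃) ∈ {±1}ⁿ be obtained by thresholding φ(L), φ(L̃) respectively at level τ. If the minimum margin γ_min = min_i |φ_i(L) − τ| is positive, then Ham(y(G), y(G̃)) ≤ (√n · C_σ · |h₁| / γ_min) · ‖L̃ − L‖₂. -/

import Mathlib

open MeasureTheory ProbabilityTheory Finset
open scoped Classical

/-- Spectral (ℓ²-operator) norm of a real square matrix. -/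
noncomputable def specNorm {n : ℕ} (M : Matrix (Fin n) (Fin n) ℝ) : ℝ :=
  ‖Matrix.toEuclideanCLM (𝕜 := ℝ) M‖

/-- Euclidean (ℓ²) norm of a vector in ℝⁿ. -/
noncomputable def evNorm {n : ℕ} (u : Fin n → ℝ) : ℝ :=
  Real.sqrt (∑ i, (u i) ^ 2)

/-- The rank-one matrix (e_i − e_j)(e_i − e_j)ᵀ, where e_k is the k-th standard basis vector. -/
noncomputable def edgeMat {n : ℕ} (i j : Fin n) : Matrix (Fin n) (Fin n) ℝ :=
  Matrix.vecMulVec (fun k => (if k = i then (1 : ℝ) else 0) - (if k = j then 1 else 0))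
    (fun k => (if k = i then (1 : ℝ) else 0) - (if k = j then 1 else 0))

/-- Combinatorial graph Laplacian L = D − A. -/
noncomputable def lap {n : ℕ} (A : Matrix (Fin n) (Fin n) ℝ) : Matrix (Fin n) (Fin n) ℝ :=
  Matrix.diagonal (fun i => ∑ j, A i j) - A

/-- All index pairs (i, j) with i < j. -/
noncomputable def pairs (n : ℕ) : Finset (Fin n × Fin n) :=
  Finset.univ.filter (fun p => p.1 < p.2)

/-- Laplacian of the edge-subsampled graph: L̂(ω) = Σ_{i<j} A_{ij} B_{ij}(ω) (e_i−e_j)(e_i−e_j)ᵀ. -/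
noncomputable def lapHat {n : ℕ} (A : Matrix (Fin n) (Fin n) ℝ) {Ω : Type*}
    (B : Fin n → Fin n → Ω → ℝ) (ω : Ω) : Matrix (Fin n) (Fin n) ℝ :=
  ∑ p ∈ pairs n, (A p.1 p.2 * B p.1 p.2 ω) • edgeMat p.1 p.2

/-- One-layer GCN output σ((h₀ I + h₁ M) x), with σ applied elementwise. -/
noncomputable def gcnOut {n : ℕ} (σ : ℝ → ℝ) (h0 h1 : ℝ) (x : Fin n → ℝ)
    (M : Matrix (Fin n) (Fin n) ℝ) : Fin n → ℝ :=
  fun i => σ (((h0 • (1 : Matrix (Fin n) (Fin n) ℝ) + h1 • M).mulVec x) i)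

/-- ±1 labels by thresholding at level τ. -/
noncomputable def thLabels {n : ℕ} (f : Fin n → ℝ) (τ : ℝ) : Fin n → ℝ :=
  fun i => if τ < f i then 1 else -1

/-- Hamming distance between two label vectors. -/
noncomputable def ham {n : ℕ} (y z : Fin n → ℝ) : ℕ :=
  (Finset.univ.filter (fun i => y i ≠ z i)).card

/-- Centered edge-subsampling matrix Y_{ij} = A_{ij}(B_{ij} − p_s)(e_i−e_j)(e_i−e_j)ᵀ. -/
noncomputable def Ymat {n : ℕ} (A : Matrix (Fin n) (Fin n) ℝ) (ps : ℝ) {Ω : Type*}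
    (B : Fin n → Fin n → Ω → ℝ) (i j : Fin n) (ω : Ω) : Matrix (Fin n) (Fin n) ℝ :=
  (A i j * (B i j ω - ps)) • edgeMat i j

/-- The matrix X_{ij} = A_{ij}(B_{ij} − 1)(e_i−e_j)(e_i−e_j)ᵀ. -/
noncomputable def Xmat {n : ℕ} (A : Matrix (Fin n) (Fin n) ℝ) {Ω : Type*}
    (B : Fin n → Fin n → Ω → ℝ) (i j : Fin n) (ω : Ω) : Matrix (Fin n) (Fin n) ℝ :=
  (A i j * (B i j ω - 1)) • edgeMat i j

/-- Entrywise expectation of a random matrix. -/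
noncomputable def matExp {n : ℕ} {Ω : Type*} [MeasurableSpace Ω] (μ : Measure Ω)
    (M : Ω → Matrix (Fin n) (Fin n) ℝ) : Matrix (Fin n) (Fin n) ℝ :=
  Matrix.of fun k l => ∫ ω, M ω k l ∂μ

/-- The single-subsample misclassification bound f(p_s, η). -/
noncomputable def fBound {n : ℕ} (L : Matrix (Fin n) (Fin n) ℝ) (Cσ h1 γmin ps η : ℝ) : ℝ :=
  Cσ * |h1| / (Real.sqrt n * γmin) *
    ((1 - ps) * specNorm L
      + Real.sqrt (4 * ps * (1 - ps) * specNorm L * Real.log (2 * n / η))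
      + 4 / 3 * Real.log (2 * n / η))

/-- Coordinatewise majority vote of m label vectors. -/
noncomputable def majority {n : ℕ} (m : ℕ) (ys : ℕ → Fin n → ℝ) : Fin n → ℝ :=
  fun i => if (m : ℝ) < 2 * (((Finset.range m).filter (fun ℓ => ys ℓ i = 1)).card : ℝ)
    then 1 else -1

/-- Flip-count lemma for a one-layer GCN: the Hamming distance between the
thresholded labelings of two symmetric Laplacians is at most (√n C_σ |h₁| / γ_min)‖L̃ − L‖₂. -/
theorem gcn_flip_count_bound {n : ℕ} (hn : 0 < n)
    (L Lt : Matrix (Fin n) (Fin n) ℝ) (hL : L.IsSymm) (hLt : Lt.IsSymm)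
    (σ : ℝ → ℝ) (Cσ : ℝ) (hσ : ∀ a b, |σ a - σ b| ≤ Cσ * |a - b|)
    (h0 h1 : ℝ) (x : Fin n → ℝ) (hx : evNorm x = 1) (τ : ℝ)
    (γmin : ℝ) (hγ : γmin = ⨅ i, |gcnOut σ h0 h1 x L i - τ|) (hγpos : 0 < γmin) :
    (ham (thLabels (gcnOut σ h0 h1 x L) τ) (thLabels (gcnOut σ h0 h1 x Lt) τ) : ℝ)
      ≤ Real.sqrt n * Cσ * |h1| / γmin * specNorm (Lt - L) := by
  have hC : 0 ≤ Cσ := by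
    have h := hσ 1 0
    have h2 := abs_nonneg (σ 1 - σ 0)
    simp at h
    linarith
  set v : Fin n → ℝ := (Lt - L).mulVec x with hv
  have hnorm : Real.sqrt (∑ i, (v i) ^ 2) ≤ specNorm (Lt - L) := by
    have h := (Matrix.toEuclideanCLM (𝕜 := ℝ) (Lt - L)).le_opNorm (WithLp.toLp 2 x)
    have hx1 : ‖(WithLp.toLp 2 x : EuclideanSpace ℝ (Fin n))‖ = 1 := by
      rw [EuclideanSpace.norm_eq]
      simpa [evNorm] using hx
    rw [hx1, mul_one, EuclideanSpace.norm_eq] at h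
    simpa [specNorm, hv, Matrix.sub_mulVec] using h
  have hsum : ∑ i, |v i| ≤ Real.sqrt n * Real.sqrt (∑ i, (v i) ^ 2) := by
    rw [← Real.sqrt_mul (Nat.cast_nonneg n)]
    apply Real.le_sqrt_of_sq_le
    have h := sq_sum_le_card_mul_sum_sq (s := (Finset.univ : Finset (Fin n))) (f := fun i => |v i|)
    simpa using h
  have hdiff : ∀ i, |gcnOut σ h0 h1 x L i - gcnOut σ h0 h1 x Lt i| ≤ Cσ * |h1| * |v i| := by
    intro i
    refine (hσ _ _).trans (le_of_eq ?_)
    rw [mul_assoc, ← abs_mul, abs_sub_comm]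
    congr 2
    simp [hv, Matrix.add_mulVec, Matrix.sub_mulVec, Matrix.smul_mulVec]
    ring
  have hflip : ∀ i, thLabels (gcnOut σ h0 h1 x L) τ i ≠ thLabels (gcnOut σ h0 h1 x Lt) τ i →
      γmin ≤ Cσ * |h1| * |v i| := by
    intro i hi
    refine le_trans ?_ (hdiff i)
    have h1' : γmin ≤ |gcnOut σ h0 h1 x L i - τ| := by
      rw [hγ]
      exact ciInf_le (Set.finite_range _).bddBelow i
    refine h1'.trans ?_
    simp only [thLabels] at hi
    split_ifs at hi with ha hb hb
    · exact absurd rfl hi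
    · rw [abs_of_pos (by linarith)]
      exact le_trans (by linarith) (le_abs_self _)
    · rw [abs_of_nonpos (by linarith)]
      exact le_trans (by linarith) (neg_le_abs _)
    · exact absurd rfl hi
  have hmain : (ham (thLabels (gcnOut σ h0 h1 x L) τ) (thLabels (gcnOut σ h0 h1 x Lt) τ) : ℝ) * γmin
      ≤ Cσ * |h1| * ∑ i, |v i| := by
    unfold ham
    rw [← nsmul_eq_mul, Finset.mul_sum]
    refine (Finset.card_nsmul_le_sum _ (fun i => Cσ * |h1| * |v i|) _ ?_).trans ?_
    · intro i hi
      exact hflip i (Finset.mem_filter.mp hi).2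
    · exact Finset.sum_le_sum_of_subset_of_nonneg (Finset.filter_subset _ _)
        (fun i _ _ => by positivity)
  rw [div_mul_eq_mul_div, le_div_iff₀ hγpos]
  calc _ ≤ _ := hmain
    _ ≤ Cσ * |h1| * (Real.sqrt n * specNorm (Lt - L)) := by
      refine mul_le_mul_of_nonneg_left (hsum.trans ?_) (by positivity)
      exact mul_le_mul_of_nonneg_left hnorm (Real.sqrt_nonneg _)
    _ = _ := by ring
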